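/- arXiv:1908.04801 — 2 statements merged into one kernel-verified Lean document; each statement's English description precedes it below -/
import Mathlib

section
/- If (M,τ,h) is an Augustinian pNC structure and ∇ is a torsion-free connection with ∇(τ_b τ_c) = 0 in the case p = 0 (i.e. ∇_a(τ_b τ_c) = 0 for the absolute clock τ with τ_{ab} = τ_a τ_b and dτ = 0), then ∇_a τ_b = 0. -/
noncomputable section

abbrev Spc (d : ℕ) := Fin d → ℝ

def pd {d : ℕ} (f : Spc d → ℝ) (μ : Fin d) (x : Spc d) : ℝ :=
  fderiv ℝ f x (Pi.single μ 1)

def Sm {d : ℕ} (f : Spc d → ℝ) : Prop := ContDiff ℝ (⊤ : ℕ∞) f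

theorem pd_mul {d : ℕ} {f g : Spc d → ℝ} {x : Spc d} (μ : Fin d)
    (hf : DifferentiableAt ℝ f x) (hg : DifferentiableAt ℝ g x) :
    pd (fun y => f y * g y) μ x = f x * pd g μ x + pd f μ x * g x := by
  simp only [pd, fderiv_fun_mul hf hg, add_apply,
    smul_apply, smul_eq_mul]
  ring

/-- If the symmetrized product of `v` with a nonzero vector `t` vanishes, then `v = 0`. -/
theorem eq_zero_of_symm_mul_eq_zero {ι K : Type*} [Field K] [CharZero K] {t v : ι → K}
    (ht : t ≠ 0) (hv : ∀ a b, v a * t b + t a * v b = 0) : v = 0 := by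
  obtain ⟨k, hk⟩ := Function.ne_iff.mp ht
  have hvk : v k = 0 := by
    have h2 : (2 * t k) * v k = 0 := by linear_combination hv k k
    exact (mul_eq_zero.mp h2).resolve_left (mul_ne_zero two_ne_zero hk)
  funext a
  have ha := hv a k
  rw [hvk, mul_zero, add_zero] at ha
  exact (mul_eq_zero.mp ha).resolve_right hk

/-- For an Augustinian Leibnizian (`p = 0`) structure with absolute clock `τ_a`
(nowhere vanishing, `dτ = 0`, `τ_{ab} = τ_a τ_b`), if a torsion-free connection `∇`
satisfies `∇_a(τ_b τ_c) = 0`, then `∇_a τ_b = 0`. -/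
theorem clock_compat (d : ℕ)
    (τc : Spc d → Fin d → ℝ) (hτsm : ∀ a, Sm (fun x => τc x a))
    (hτnz : ∀ x, τc x ≠ 0)
    (h : Spc d → Fin d → Fin d → ℝ)
    (hhτ : ∀ x a, ∑ b, h x a b * τc x b = 0)
    (hclosed : ∀ x μ ν, pd (fun y => τc y ν) μ x = pd (fun y => τc y μ) ν x)
    (Γ : Spc d → Fin d → Fin d → Fin d → ℝ)
    (htf : ∀ x l μ ν, Γ x l μ ν = Γ x l ν μ)
    (hcompat : ∀ x a b c₀, pd (fun y => τc y a * τc y b) c₀ x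
        - (∑ e, Γ x e a c₀ * τc x e * τc x b)
        - (∑ e, Γ x e b c₀ * τc x a * τc x e) = 0) :
    ∀ x a b, pd (fun y => τc y a) b x - (∑ e, Γ x e a b * τc x e) = 0 := by
  intro x a b
  have hd (i : Fin d) : DifferentiableAt ℝ (fun y => τc y i) x :=
    (hτsm i).differentiable (by simp) x
  refine congrFun (eq_zero_of_symm_mul_eq_zero
    (v := fun i => pd (fun y => τc y i) b x - ∑ e, Γ x e i b * τc x e) (hτnz x)
    fun i j => ?_) a
  have hij := hcompat x i j b
  have hsum : ∑ e, Γ x e j b * τc x i * τc x e = τc x i * ∑ e, Γ x e j b * τc x e := by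
    rw [Finset.mul_sum]
    exact Finset.sum_congr rfl fun e _ => by ring
  rw [pd_mul b (hd i) (hd j), ← Finset.sum_mul, hsum] at hij
  linear_combination hij
end
end

section
/- Given an Augustinian pNC structure (M,τ,h) and a longitudinal frame τ_A, there exists a unique torsion-free compatible connection ∇ whose induced gravitational field strength F(∇)_{Aab} = 2ĥ_{c[b}∇_{a]}τ^c_A lies in Ker(φ) (i.e. its class vanishes); its coefficients in any coordinate chart are Γ^λ_{μν} = ½ τ̂^{λγ}(∂_μ τ_{νγ} + ∂_ν τ_{μγ} − ∂_γ τ_{μν}) + ½ h^{λγ}(∂_μ ĥ_{νγ} + ∂_ν ĥ_{μγ} − ∂_γ ĥ_{μν}). -/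
noncomputable section

def eta' (p : ℕ) (A B : Fin (p+1)) : ℝ :=
  if A = B then (if A = 0 then -1 else 1) else 0

/-- `τ_{ab} = η_{AB} τ^A_a τ^B_b`. -/
def tauOf (d p : ℕ) (c : Spc d → Fin (p+1) → Fin d → ℝ) : Spc d → Fin d → Fin d → ℝ :=
  fun x a b => ∑ A, ∑ B, eta' p A B * c x A a * c x B b

/-- `h^{ab} = δ^{ij} e_i^a e_j^b`. -/
def hOf (d q : ℕ) (e : Spc d → Fin q → Fin d → ℝ) : Spc d → Fin d → Fin d → ℝ :=
  fun x a b => ∑ i, e x i a * e x i b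

/-- `ĥ_{ab} = δ_{ij} f^i_a f^j_b`. -/
def hhatOf (d q : ℕ) (f : Spc d → Fin q → Fin d → ℝ) : Spc d → Fin d → Fin d → ℝ :=
  fun x a b => ∑ i, f x i a * f x i b

/-- `τ̂^{ab} = η^{AB} τ_A^a τ_B^b`. -/
def tauhatOf (d p : ℕ) (t : Spc d → Fin (p+1) → Fin d → ℝ) : Spc d → Fin d → Fin d → ℝ :=
  fun x a b => ∑ A, ∑ B, eta' p A B * t x A a * t x B b

def CompatLower (d : ℕ) (Γ : Spc d → Fin d → Fin d → Fin d → ℝ)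
    (τ : Spc d → Fin d → Fin d → ℝ) : Prop :=
  ∀ x a b c₀, pd (fun y => τ y a b) c₀ x
    - (∑ e, Γ x e a c₀ * τ x e b) - (∑ e, Γ x e b c₀ * τ x a e) = 0

def CompatUpper (d : ℕ) (Γ : Spc d → Fin d → Fin d → Fin d → ℝ)
    (h : Spc d → Fin d → Fin d → ℝ) : Prop :=
  ∀ x a b c₀, pd (fun y => h y a b) c₀ x
    + (∑ e, Γ x a e c₀ * h x e b) + (∑ e, Γ x b e c₀ * h x a e) = 0

/-- `(∇_a X)^{c}` for a vector field `X`. -/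
def covd (d : ℕ) (Γ : Spc d → Fin d → Fin d → Fin d → ℝ)
    (X : Spc d → Fin d → ℝ) (a c₀ : Fin d) (x : Spc d) : ℝ :=
  pd (fun y => X y c₀) a x + ∑ e, Γ x c₀ e a * X x e

/-- The gravitational field strength `F(∇)_{Aab} = 2ĥ_{c[b}∇_{a]}τ^c_A`. -/
def Fstr (d p : ℕ) (Γ : Spc d → Fin d → Fin d → Fin d → ℝ)
    (t : Spc d → Fin (p+1) → Fin d → ℝ) (hh : Spc d → Fin d → Fin d → ℝ)
    (A : Fin (p+1)) (a b : Fin d) (x : Spc d) : ℝ :=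
  ∑ c₀, (hh x c₀ b * covd d Γ (fun y => t y A) a c₀ x
       - hh x c₀ a * covd d Γ (fun y => t y A) b c₀ x)

/-- The tuple of 2-forms `F_A` lies in `Ker φ` (its class vanishes). -/
def FInKer (d p : ℕ) (τ : Spc d → Fin d → Fin d → ℝ)
    (t : Spc d → Fin (p+1) → Fin d → ℝ)
    (Fm : Fin (p+1) → Fin d → Fin d → Spc d → ℝ) : Prop :=
  (∀ x A B (v : Fin d → ℝ), (∀ a, ∑ b, τ x a b * v b = 0) →
    (∑ μ, ∑ ν, t x B μ * Fm A μ ν x * v ν) = -(∑ μ, ∑ ν, t x A μ * Fm B μ ν x * v ν)) ∧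
  (∀ x A (v w : Fin d → ℝ), (∀ a, ∑ b, τ x a b * v b = 0) →
    (∀ a, ∑ b, τ x a b * w b = 0) →
    (∑ μ, ∑ ν, v μ * Fm A μ ν x * w ν) = 0)

/-- A torsion-free special connection candidate: smooth, torsion-free, compatible, and
with vanishing induced gravitational field strength class with respect to `τ_A`. -/
def GoodConn (d p q : ℕ) (t c : Spc d → Fin (p+1) → Fin d → ℝ)
    (e f : Spc d → Fin q → Fin d → ℝ)
    (Γ : Spc d → Fin d → Fin d → Fin d → ℝ) : Prop :=
  (∀ l μ ν, Sm (fun x => Γ x l μ ν)) ∧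
  (∀ x l μ ν, Γ x l μ ν = Γ x l ν μ) ∧
  CompatLower d Γ (tauOf d p c) ∧
  CompatUpper d Γ (hOf d q e) ∧
  FInKer d p (tauOf d p c) t (fun A a b x => Fstr d p Γ t (hhatOf d q f) A a b x)

/-- `Γ^λ_{μν} = ½ τ̂^{λγ}(∂_μ τ_{νγ} + ∂_ν τ_{μγ} − ∂_γ τ_{μν})
  + ½ h^{λγ}(∂_μ ĥ_{νγ} + ∂_ν ĥ_{μγ} − ∂_γ ĥ_{μν})`. -/
def SpecialConn (d p q : ℕ) (t c : Spc d → Fin (p+1) → Fin d → ℝ)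
    (e f : Spc d → Fin q → Fin d → ℝ) : Spc d → Fin d → Fin d → Fin d → ℝ :=
  fun x l μ ν =>
    (1/2 : ℝ) * (∑ g, tauhatOf d p t x l g *
      (pd (fun y => tauOf d p c y ν g) μ x + pd (fun y => tauOf d p c y μ g) ν x
        - pd (fun y => tauOf d p c y μ ν) g x))
    + (1/2 : ℝ) * (∑ g, hOf d q e x l g *
      (pd (fun y => hhatOf d q f y ν g) μ x + pd (fun y => hhatOf d q f y μ g) ν x
        - pd (fun y => hhatOf d q f y μ ν) g x))


section Calculus

variable {d : ℕ}

theorem Sm.differentiable {f : Spc d → ℝ} (hf : Sm f) : Differentiable ℝ f :=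
  ContDiff.differentiable hf (by simp)

theorem Sm.add {f g : Spc d → ℝ} (hf : Sm f) (hg : Sm g) : Sm (fun x => f x + g x) :=
  ContDiff.add hf hg

theorem Sm.sub {f g : Spc d → ℝ} (hf : Sm f) (hg : Sm g) : Sm (fun x => f x - g x) :=
  ContDiff.sub hf hg

theorem Sm.mul {f g : Spc d → ℝ} (hf : Sm f) (hg : Sm g) : Sm (fun x => f x * g x) :=
  ContDiff.mul hf hg

theorem Sm.const (r : ℝ) : Sm (fun _ : Spc d => r) := contDiff_const

theorem Sm.sum {ι : Type*} {s : Finset ι} {f : ι → Spc d → ℝ} (hf : ∀ i, Sm (f i)) :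
    Sm (fun x => ∑ i ∈ s, f i x) :=
  ContDiff.sum fun i _ => hf i

theorem Sm.pd {f : Spc d → ℝ} (hf : Sm f) (m : Fin d) : Sm (pd f m) :=
  ContDiff.clm_apply (ContDiff.fderiv_right (m := (⊤ : ℕ∞)) hf (by simp)) contDiff_const

theorem pd_sum_mul {ι : Type*} [Fintype ι] {u v : ι → Spc d → ℝ} (hu : ∀ i, Sm (u i))
    (hv : ∀ i, Sm (v i)) (m : Fin d) (x : Spc d) :
    pd (fun y => ∑ i, u i y * v i y) m x
      = ∑ i, (pd (u i) m x * v i x + u i x * pd (v i) m x) := by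
  unfold pd
  rw [fderiv_fun_sum fun i _ => ((hu i).mul (hv i)).differentiable x]
  rw [_root_.sum_apply]
  refine Finset.sum_congr rfl fun i _ => ?_
  rw [fderiv_fun_mul ((hu i).differentiable x) ((hv i).differentiable x)]
  simp only [_root_.add_apply, _root_.smul_apply, smul_eq_mul]
  ring

theorem pd_const (r : ℝ) (m : Fin d) (x : Spc d) : pd (fun _ => r) m x = 0 := by
  simp [pd]

end Calculus

/-- Vectors `t`, `e` and covectors `c`, `f` at a point that form mutually dual frames. -/
structure DualFrames {d n q : ℕ} (t c : Fin n → Fin d → ℝ) (e f : Fin q → Fin d → ℝ) :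
    Prop where
  ct : ∀ A B, c A ⬝ᵥ t B = if A = B then (1 : ℝ) else 0
  ce : ∀ A i, c A ⬝ᵥ e i = 0
  ft : ∀ i A, f i ⬝ᵥ t A = 0
  fe : ∀ i j, f i ⬝ᵥ e j = if i = j then (1 : ℝ) else 0
  comp : ∀ a b, ((∑ A, t A a * c A b) + ∑ i, e i a * f i b) = if a = b then (1 : ℝ) else 0

namespace DualFrames

variable {d n q : ℕ} {t c : Fin n → Fin d → ℝ} {e f : Fin q → Fin d → ℝ}

theorem covector_expand (F : DualFrames t c e f) (u : Fin d → ℝ) (b : Fin d) :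
    u b = ∑ A, c A b * (t A ⬝ᵥ u) + ∑ i, f i b * (e i ⬝ᵥ u) := by
  have h : u b = ∑ a, u a * (if a = b then (1 : ℝ) else 0) := by simp
  rw [h]
  simp only [← F.comp, mul_add, Finset.sum_add_distrib, dotProduct, Finset.mul_sum]
  congr 1 <;> rw [Finset.sum_comm] <;>
    exact Finset.sum_congr rfl fun _ _ => Finset.sum_congr rfl fun _ _ => by ring

theorem vector_expand (F : DualFrames t c e f) (v : Fin d → ℝ) (a : Fin d) :
    v a = ∑ A, t A a * (c A ⬝ᵥ v) + ∑ i, e i a * (f i ⬝ᵥ v) := by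
  have h : v a = ∑ b, v b * (if a = b then (1 : ℝ) else 0) := by simp
  rw [h]
  simp only [← F.comp, mul_add, Finset.sum_add_distrib, dotProduct, Finset.mul_sum]
  congr 1 <;> rw [Finset.sum_comm] <;>
    exact Finset.sum_congr rfl fun _ _ => Finset.sum_congr rfl fun _ _ => by ring

theorem covector_eq_zero (F : DualFrames t c e f) {u : Fin d → ℝ} (ht : ∀ A, t A ⬝ᵥ u = 0)
    (he : ∀ i, e i ⬝ᵥ u = 0) (b : Fin d) : u b = 0 := by
  rw [F.covector_expand u b]; simp [ht, he]

theorem vector_eq_zero (F : DualFrames t c e f) {v : Fin d → ℝ} (hc : ∀ A, c A ⬝ᵥ v = 0)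
    (hf : ∀ i, f i ⬝ᵥ v = 0) (a : Fin d) : v a = 0 := by
  rw [F.vector_expand v a]; simp [hc, hf]

end DualFrames

section Metric

variable {d p q : ℕ}

theorem eta'_mul_self (A : Fin (p + 1)) : eta' p A A * eta' p A A = 1 := by
  unfold eta'; split_ifs <;> simp_all

theorem sum_eta'_mul (A : Fin (p + 1)) (X : Fin (p + 1) → ℝ) :
    ∑ B, eta' p A B * X B = eta' p A A * X A := by
  rw [Finset.sum_eq_single A] <;> simp +contextual [eta', eq_comm]

theorem sum_eta'_mul' (A : Fin (p + 1)) (X : Fin (p + 1) → ℝ) :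
    ∑ B, eta' p B A * X B = eta' p A A * X A := by
  rw [Finset.sum_eq_single A] <;> simp +contextual [eta']

theorem tauOf_eq (c : Spc d → Fin (p + 1) → Fin d → ℝ) (x : Spc d) (a b : Fin d) :
    tauOf d p c x a b = ∑ A, (eta' p A A * c x A a) * c x A b := by
  unfold tauOf
  refine Finset.sum_congr rfl fun A _ => ?_
  rw [mul_assoc, ← sum_eta'_mul A (fun B => c x A a * c x B b)]
  simp only [mul_assoc]

theorem tauhatOf_eq (t : Spc d → Fin (p + 1) → Fin d → ℝ) (x : Spc d) (a b : Fin d) :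
    tauhatOf d p t x a b = ∑ A, (eta' p A A * t x A a) * t x A b := tauOf_eq t x a b

theorem tauOf_symm (c : Spc d → Fin (p + 1) → Fin d → ℝ) (x : Spc d) (a b : Fin d) :
    tauOf d p c x a b = tauOf d p c x b a := by
  simp only [tauOf_eq]; exact Finset.sum_congr rfl fun _ _ => by ring

theorem hhatOf_symm (f : Spc d → Fin q → Fin d → ℝ) (x : Spc d) (a b : Fin d) :
    hhatOf d q f x a b = hhatOf d q f x b a := by
  simp only [hhatOf]; exact Finset.sum_congr rfl fun _ _ => by ring

theorem sum_mul_tauOf (c : Spc d → Fin (p + 1) → Fin d → ℝ) (x : Spc d) (v : Fin d → ℝ)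
    (b : Fin d) :
    ∑ a, v a * tauOf d p c x a b = ∑ A, eta' p A A * (c x A ⬝ᵥ v) * c x A b := by
  simp only [tauOf_eq, dotProduct, Finset.mul_sum, Finset.sum_mul]
  rw [Finset.sum_comm]
  exact Finset.sum_congr rfl fun _ _ => Finset.sum_congr rfl fun _ _ => by ring

theorem sum_mul_hhatOf (f : Spc d → Fin q → Fin d → ℝ) (x : Spc d) (v : Fin d → ℝ)
    (b : Fin d) :
    ∑ a, v a * hhatOf d q f x a b = ∑ i, f x i b * (f x i ⬝ᵥ v) := by
  simp only [hhatOf, dotProduct, Finset.mul_sum]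
  rw [Finset.sum_comm]
  exact Finset.sum_congr rfl fun _ _ => Finset.sum_congr rfl fun _ _ => by ring

theorem sum_tauOf_mul_eq_zero {c : Spc d → Fin (p + 1) → Fin d → ℝ} {x : Spc d}
    {v : Fin d → ℝ} (hv : ∀ A, c x A ⬝ᵥ v = 0) (a : Fin d) :
    ∑ b, tauOf d p c x a b * v b = 0 := by
  simp only [tauOf_symm c x a, mul_comm _ (v _)]
  rw [sum_mul_tauOf]; simp [hv]

theorem DualFrames.sum_mul_tauOf_dotProduct {t c : Spc d → Fin (p + 1) → Fin d → ℝ}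
    {e f : Fin q → Fin d → ℝ} {x : Spc d} (F : DualFrames (t x) (c x) e f) (v : Fin d → ℝ)
    (A : Fin (p + 1)) :
    ∑ b, (∑ a, v a * tauOf d p c x a b) * t x A b = eta' p A A * (c x A ⬝ᵥ v) := by
  simp only [sum_mul_tauOf, Finset.sum_mul]
  rw [Finset.sum_comm]
  have h : ∀ B, ∑ b, eta' p B B * (c x B ⬝ᵥ v) * c x B b * t x A b
      = eta' p B B * (c x B ⬝ᵥ v) * if B = A then (1 : ℝ) else 0 := fun B => by
    rw [← F.ct B A, show c x B ⬝ᵥ t x A = ∑ b, c x B b * t x A b from rfl, Finset.mul_sum]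
    simp only [mul_assoc]
  simp [h]

theorem DualFrames.dotProduct_eq_zero {t c : Spc d → Fin (p + 1) → Fin d → ℝ}
    {e f : Fin q → Fin d → ℝ} {x : Spc d} (F : DualFrames (t x) (c x) e f) {v : Fin d → ℝ}
    (hv : ∀ b, ∑ a, v a * tauOf d p c x a b = 0) (A : Fin (p + 1)) : c x A ⬝ᵥ v = 0 := by
  have h := F.sum_mul_tauOf_dotProduct v A
  simp only [hv, zero_mul, Finset.sum_const_zero] at h
  have h2 := eta'_mul_self A
  calc c x A ⬝ᵥ v = (eta' p A A * eta' p A A) * (c x A ⬝ᵥ v) := by rw [h2, one_mul]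
    _ = 0 := by rw [mul_assoc, ← h, mul_zero]

theorem DualFrames.sum_mul_hhatOf_e {t c : Fin (p + 1) → Fin d → ℝ}
    {e f : Spc d → Fin q → Fin d → ℝ} {x : Spc d} (F : DualFrames t c (e x) (f x))
    (i : Fin q) (b : Fin d) : ∑ a, e x i a * hhatOf d q f x a b = f x i b := by
  simp [sum_mul_hhatOf, F.fe]

theorem DualFrames.sum_mul_hhatOf_t {t c : Fin (p + 1) → Fin d → ℝ}
    {e f : Spc d → Fin q → Fin d → ℝ} {x : Spc d} (F : DualFrames t c (e x) (f x))
    (A : Fin (p + 1)) (b : Fin d) : ∑ a, t A a * hhatOf d q f x a b = 0 := by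
  simp [sum_mul_hhatOf, F.ft]

end Metric

/-- The Christoffel symbols of the first kind of a symmetric 2-tensor field, with the lowered
index first. -/
def chris {d : ℕ} (g : Spc d → Fin d → Fin d → ℝ) (x : Spc d) (k μ ν : Fin d) : ℝ :=
  (1 / 2) * (pd (fun y => g y ν k) μ x + pd (fun y => g y μ k) ν x - pd (fun y => g y μ ν) k x)

section Christoffel

variable {d : ℕ} {g : Spc d → Fin d → Fin d → ℝ}

theorem pd_swap (hg : ∀ x a b, g x a b = g x b a) (a b m : Fin d) (x : Spc d) :
    pd (fun y => g y a b) m x = pd (fun y => g y b a) m x := by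
  simp only [fun y => hg y a b]

theorem chris_symm (hg : ∀ x a b, g x a b = g x b a) (x : Spc d) (k μ ν : Fin d) :
    chris g x k μ ν = chris g x k ν μ := by
  unfold chris; rw [pd_swap hg ν μ]; ring

theorem chris_add_chris (hg : ∀ x a b, g x a b = g x b a) (x : Spc d) (a b m : Fin d) :
    chris g x b a m + chris g x a b m = pd (fun y => g y a b) m x := by
  unfold chris; rw [pd_swap hg b a, pd_swap hg m b, pd_swap hg m a]; ring

end Christoffel

/-- A smooth Galilean frame: smooth fields that are mutually dual at every point. -/
structure GalileanFrame {d p q : ℕ} (t c : Spc d → Fin (p + 1) → Fin d → ℝ)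
    (e f : Spc d → Fin q → Fin d → ℝ) : Prop where
  tsm : ∀ A a, Sm (fun x => t x A a)
  csm : ∀ A a, Sm (fun x => c x A a)
  esm : ∀ i a, Sm (fun x => e x i a)
  fsm : ∀ i a, Sm (fun x => f x i a)
  dual : ∀ x, DualFrames (t x) (c x) (e x) (f x)

section Smooth

variable {d p q : ℕ}

theorem sm_tauOf {c : Spc d → Fin (p + 1) → Fin d → ℝ} (hc : ∀ A a, Sm (fun x => c x A a))
    (a b : Fin d) : Sm (fun x => tauOf d p c x a b) :=
  Sm.sum fun A => Sm.sum fun B => ((Sm.const _).mul (hc A a)).mul (hc B b)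

theorem sm_hhatOf {f : Spc d → Fin q → Fin d → ℝ} (hf : ∀ i a, Sm (fun x => f x i a))
    (a b : Fin d) : Sm (fun x => hhatOf d q f x a b) :=
  Sm.sum fun i => (hf i a).mul (hf i b)

theorem GalileanFrame.sm_specialConn {t c : Spc d → Fin (p + 1) → Fin d → ℝ}
    {e f : Spc d → Fin q → Fin d → ℝ} (G : GalileanFrame t c e f) (l μ ν : Fin d) :
    Sm (fun x => SpecialConn d p q t c e f x l μ ν) := by
  have hT := sm_tauOf G.csm
  have hH := sm_hhatOf G.fsm
  exact ((Sm.const _).mul (Sm.sum fun g => (sm_tauOf G.tsm l g).mul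
    ((((hT ν g).pd μ).add ((hT μ g).pd ν)).sub ((hT μ ν).pd g)))).add
    ((Sm.const _).mul (Sm.sum fun g => (sm_hhatOf G.esm l g).mul
    ((((hH ν g).pd μ).add ((hH μ g).pd ν)).sub ((hH μ ν).pd g))))

end Smooth

theorem pd_const_mul {d : ℕ} {f : Spc d → ℝ} (hf : Sm f) (r : ℝ) (m : Fin d) (x : Spc d) :
    pd (fun y => r * f y) m x = r * pd f m x := by
  have h := pd_sum_mul (ι := Unit) (u := fun _ _ => r) (v := fun _ => f)
    (fun _ => Sm.const r) (fun _ => hf) m x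
  simpa [pd_const] using h

theorem pd_tauOf {d p : ℕ} {c : Spc d → Fin (p + 1) → Fin d → ℝ}
    (hc : ∀ A a, Sm (fun x => c x A a)) (x : Spc d) (a b m : Fin d) :
    pd (fun y => tauOf d p c y a b) m x
      = ∑ A, eta' p A A * (pd (fun y => c y A a) m x * c x A b
          + c x A a * pd (fun y => c y A b) m x) := by
  simp only [tauOf_eq]
  rw [pd_sum_mul (fun A => (Sm.const _).mul (hc A a)) (fun A => hc A b)]
  refine Finset.sum_congr rfl fun A _ => ?_
  rw [pd_const_mul (hc A a)]
  ring

namespace GalileanFrame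

variable {d p q : ℕ} {t c : Spc d → Fin (p + 1) → Fin d → ℝ} {e f : Spc d → Fin q → Fin d → ℝ}

theorem e_transverse (G : GalileanFrame t c e f) (x : Spc d) (i : Fin q) (a : Fin d) :
    ∑ b, tauOf d p c x a b * e x i b = 0 :=
  sum_tauOf_mul_eq_zero (fun A => (G.dual x).ce A i) a

theorem sum_e_mul_tauOf (G : GalileanFrame t c e f) (x : Spc d) (i : Fin q) (b : Fin d) :
    ∑ a, e x i a * tauOf d p c x a b = 0 := by
  simp [sum_mul_tauOf, (G.dual x).ce]

theorem dotProduct_chris_tauOf (G : GalileanFrame t c e f) (x : Spc d) (i : Fin q)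
    (μ ν : Fin d) :
    (e x i ⬝ᵥ fun k => chris (tauOf d p c) x k μ ν)
      = (1 / 2) * ∑ A, eta' p A A *
        (c x A ν * (∑ k, e x i k * (pd (fun y => c y A k) μ x - pd (fun y => c y A μ) k x))
        + c x A μ * (∑ k, e x i k *
          (pd (fun y => c y A k) ν x - pd (fun y => c y A ν) k x))) := by
  have key : ∀ A, (c x A ν * (∑ k, e x i k *
          (pd (fun y => c y A k) μ x - pd (fun y => c y A μ) k x))
        + c x A μ * (∑ k, e x i k *
          (pd (fun y => c y A k) ν x - pd (fun y => c y A ν) k x)))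
      = ∑ k, e x i k * (pd (fun y => c y A ν) μ x * c x A k
          + c x A ν * pd (fun y => c y A k) μ x + (pd (fun y => c y A μ) ν x * c x A k
          + c x A μ * pd (fun y => c y A k) ν x) - (pd (fun y => c y A μ) k x * c x A ν
          + c x A μ * pd (fun y => c y A ν) k x)) := fun A => by
    have h0 : (∑ k, c x A k * e x i k) * (pd (fun y => c y A ν) μ x + pd (fun y => c y A μ) ν x)
        = 0 := by
      rw [show ∑ k, c x A k * e x i k = 0 from (G.dual x).ce A i, zero_mul]
    rw [← add_zero (_ + _), ← h0]
    simp only [Finset.mul_sum, Finset.sum_mul, ← Finset.sum_add_distrib]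
    exact Finset.sum_congr rfl fun _ _ => by ring
  simp only [key]
  simp only [dotProduct, chris, pd_tauOf G.csm, ← Finset.sum_add_distrib,
    ← Finset.sum_sub_distrib, Finset.mul_sum]
  rw [Finset.sum_comm]
  exact Finset.sum_congr rfl fun _ _ => Finset.sum_congr rfl fun _ _ => by ring

/-- The first-kind Christoffel symbols of `τ` of an Augustinian structure annihilate transverse
vectors. -/
theorem dotProduct_chris_tauOf_eq_zero (G : GalileanFrame t c e f)
    (haug1 : ∀ x A (v w : Fin d → ℝ),
      (∀ a, ∑ b, tauOf d p c x a b * v b = 0) →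
      (∀ a, ∑ b, tauOf d p c x a b * w b = 0) →
      ∑ μ, ∑ ν, v μ * w ν *
        (pd (fun y => c y A ν) μ x - pd (fun y => c y A μ) ν x) = 0)
    (haug2 : ∀ x B C (v : Fin d → ℝ),
      (∀ a, ∑ b, tauOf d p c x a b * v b = 0) →
      ∑ A, (eta' p A B * (∑ μ, ∑ ν, t x C μ * v ν *
              (pd (fun y => c y A ν) μ x - pd (fun y => c y A μ) ν x))
          + eta' p A C * (∑ μ, ∑ ν, t x B μ * v ν *
              (pd (fun y => c y A ν) μ x - pd (fun y => c y A μ) ν x))) = 0)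
    (x : Spc d) (i : Fin q) (μ ν : Fin d) :
    (e x i ⬝ᵥ fun k => chris (tauOf d p c) x k μ ν) = 0 := by
  rw [G.dotProduct_chris_tauOf]
  set W : Fin (p + 1) → Fin d → ℝ := fun A m =>
    ∑ k, e x i k * (pd (fun y => c y A k) m x - pd (fun y => c y A m) k x) with hW
  have contract : ∀ A (v : Fin d → ℝ), ∑ m, ∑ k, v m * e x i k *
      (pd (fun y => c y A k) m x - pd (fun y => c y A m) k x) = v ⬝ᵥ W A := fun A v => by
    simp only [hW, dotProduct, Finset.mul_sum, mul_assoc]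
  have hWe : ∀ A j, e x j ⬝ᵥ W A = 0 := fun A j => by
    rw [← contract]
    exact haug1 x A _ _ (G.e_transverse x j) (G.e_transverse x i)
  have hWt : ∀ B C, eta' p B B * (t x C ⬝ᵥ W B) + eta' p C C * (t x B ⬝ᵥ W C) = 0 :=
    fun B C => by
      have h := haug2 x B C _ (G.e_transverse x i)
      simpa only [contract, Finset.sum_add_distrib, sum_eta'_mul'] using h
  have hexp : ∀ A m, W A m = ∑ C, c x C m * (t x C ⬝ᵥ W A) := fun A m => by
    rw [(G.dual x).covector_expand (W A) m]; simp [hWe]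
  change (1 / 2) * ∑ A, eta' p A A * (c x A ν * W A μ + c x A μ * W A ν) = 0
  have hsum : ∑ A, eta' p A A * (c x A ν * W A μ + c x A μ * W A ν) = 0 := by
    calc ∑ A, eta' p A A * (c x A ν * W A μ + c x A μ * W A ν)
        = (∑ A, ∑ C, eta' p A A * (c x A ν * (c x C μ * (t x C ⬝ᵥ W A))))
          + ∑ A, ∑ C, eta' p A A * (c x A μ * (c x C ν * (t x C ⬝ᵥ W A))) := by
          simp only [hexp _ μ, hexp _ ν, mul_add, Finset.sum_add_distrib, Finset.mul_sum]
      _ = ∑ A, ∑ C, c x A ν * c x C μ *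
            (eta' p A A * (t x C ⬝ᵥ W A) + eta' p C C * (t x A ⬝ᵥ W C)) := by
          rw [Finset.sum_comm (f := fun A C =>
            eta' p A A * (c x A μ * (c x C ν * (t x C ⬝ᵥ W A))))]
          simp only [← Finset.sum_add_distrib]
          exact Finset.sum_congr rfl fun _ _ => Finset.sum_congr rfl fun _ _ => by ring
      _ = 0 := by simp [hWt]
  rw [hsum, mul_zero]

end GalileanFrame

namespace DualFrames

variable {d n q : ℕ} {t c : Fin n → Fin d → ℝ} {e f : Fin q → Fin d → ℝ}

theorem dotProduct_combination (u : Fin d → ℝ) (X : Fin n → ℝ) (Y : Fin q → ℝ) :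
    (u ⬝ᵥ fun l => ∑ A, t A l * X A + ∑ i, e i l * Y i)
      = ∑ A, (u ⬝ᵥ t A) * X A + ∑ i, (u ⬝ᵥ e i) * Y i := by
  simp only [dotProduct, mul_add, Finset.sum_add_distrib, Finset.mul_sum, Finset.sum_mul]
  congr 1 <;> rw [Finset.sum_comm] <;>
    exact Finset.sum_congr rfl fun _ _ => Finset.sum_congr rfl fun _ _ => by ring

theorem c_dotProduct_combination (F : DualFrames t c e f) (X : Fin n → ℝ) (Y : Fin q → ℝ)
    (B : Fin n) : (c B ⬝ᵥ fun l => ∑ A, t A l * X A + ∑ i, e i l * Y i) = X B := by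
  rw [dotProduct_combination]; simp [F.ct, F.ce]

theorem f_dotProduct_combination (F : DualFrames t c e f) (X : Fin n → ℝ) (Y : Fin q → ℝ)
    (j : Fin q) : (f j ⬝ᵥ fun l => ∑ A, t A l * X A + ∑ i, e i l * Y i) = Y j := by
  rw [dotProduct_combination]; simp [F.ft, F.fe]

end DualFrames

theorem specialConn_eq {d p q : ℕ} (t c : Spc d → Fin (p + 1) → Fin d → ℝ)
    (e f : Spc d → Fin q → Fin d → ℝ) (x : Spc d) (l μ ν : Fin d) :
    SpecialConn d p q t c e f x l μ ν
      = ∑ A, t x A l * (eta' p A A * (t x A ⬝ᵥ fun k => chris (tauOf d p c) x k μ ν))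
        + ∑ i, e x i l * (e x i ⬝ᵥ fun k => chris (hhatOf d q f) x k μ ν) := by
  simp only [SpecialConn, tauhatOf_eq, hOf, chris, dotProduct, Finset.mul_sum, Finset.sum_mul]
  congr 1 <;> rw [Finset.sum_comm] <;>
    exact Finset.sum_congr rfl fun _ _ => Finset.sum_congr rfl fun _ _ => by ring

namespace GalileanFrame

variable {d p q : ℕ} {t c : Spc d → Fin (p + 1) → Fin d → ℝ} {e f : Spc d → Fin q → Fin d → ℝ}

theorem c_dotProduct_specialConn (G : GalileanFrame t c e f) (x : Spc d) (A : Fin (p + 1))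
    (μ ν : Fin d) :
    (c x A ⬝ᵥ fun l => SpecialConn d p q t c e f x l μ ν)
      = eta' p A A * (t x A ⬝ᵥ fun k => chris (tauOf d p c) x k μ ν) := by
  simp only [specialConn_eq]
  exact (G.dual x).c_dotProduct_combination _ _ A

theorem f_dotProduct_specialConn (G : GalileanFrame t c e f) (x : Spc d) (i : Fin q)
    (μ ν : Fin d) :
    (f x i ⬝ᵥ fun l => SpecialConn d p q t c e f x l μ ν)
      = e x i ⬝ᵥ fun k => chris (hhatOf d q f) x k μ ν := by
  simp only [specialConn_eq]
  exact (G.dual x).f_dotProduct_combination _ _ i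

theorem specialConn_symm (x : Spc d) (l μ ν : Fin d) :
    SpecialConn d p q t c e f x l μ ν = SpecialConn d p q t c e f x l ν μ := by
  simp only [specialConn_eq, fun k => chris_symm (tauOf_symm (p := p) c) x k μ ν,
    fun k => chris_symm (hhatOf_symm f) x k μ ν]

theorem compatLower_specialConn (G : GalileanFrame t c e f)
    (haug : ∀ x i μ ν, (e x i ⬝ᵥ fun k => chris (tauOf d p c) x k μ ν) = 0) :
    CompatLower d (SpecialConn d p q t c e f) (tauOf d p c) := by
  have lower : ∀ x μ ν b, ∑ l, SpecialConn d p q t c e f x l μ ν * tauOf d p c x l b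
      = chris (tauOf d p c) x b μ ν := fun x μ ν b => by
    rw [sum_mul_tauOf,
      (G.dual x).covector_expand (fun k => chris (tauOf d p c) x k μ ν) b]
    simp only [G.c_dotProduct_specialConn, haug, mul_zero, Finset.sum_const_zero, add_zero,
      ← mul_assoc, eta'_mul_self, one_mul]
    exact Finset.sum_congr rfl fun _ _ => mul_comm _ _
  intro x a b m
  simp only [tauOf_symm c x a]
  rw [lower, lower, ← chris_add_chris (tauOf_symm c) x a b m]
  ring

/-- A connection preserving `τ` preserves the transverse distribution. -/
theorem c_dotProduct_covd_e (G : GalileanFrame t c e f) {Γ : Spc d → Fin d → Fin d → Fin d → ℝ}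
    (hΓ : CompatLower d Γ (tauOf d p c)) (x : Spc d) (A : Fin (p + 1)) (i : Fin q) (m : Fin d) :
    (c x A ⬝ᵥ fun a => covd d Γ (fun y => e y i) m a x) = 0 := by
  refine (G.dual x).dotProduct_eq_zero (fun b => ?_) A
  have h1 := pd_sum_mul (fun a => G.esm i a) (fun a => sm_tauOf (p := p) G.csm a b) m x
  simp only [G.sum_e_mul_tauOf, pd_const] at h1
  have h2 : ∑ k, e x i k * (pd (fun y => tauOf d p c y k b) m x
      - (∑ a, Γ x a k m * tauOf d p c x a b) - (∑ a, Γ x a b m * tauOf d p c x k a)) = 0 := by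
    simp [hΓ x]
  have h3 : ∑ k, e x i k * (∑ a, Γ x a b m * tauOf d p c x k a) = 0 := by
    have : ∑ a, Γ x a b m * ∑ k, e x i k * tauOf d p c x k a = 0 := by
      simp [G.sum_e_mul_tauOf]
    rw [← this]
    simp only [Finset.mul_sum]
    rw [Finset.sum_comm]
    exact Finset.sum_congr rfl fun _ _ => Finset.sum_congr rfl fun _ _ => by ring
  have h4 : ∑ k, e x i k * (∑ a, Γ x a k m * tauOf d p c x a b)
      = ∑ a, (∑ k, Γ x a k m * e x i k) * tauOf d p c x a b := by
    simp only [Finset.mul_sum, Finset.sum_mul]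
    rw [Finset.sum_comm]
    exact Finset.sum_congr rfl fun _ _ => Finset.sum_congr rfl fun _ _ => by ring
  simp only [mul_sub, Finset.sum_sub_distrib, h3, h4] at h2
  simp only [Finset.sum_add_distrib] at h1
  simp only [covd, add_mul, Finset.sum_add_distrib]
  linarith

theorem sum_f_mul_pd_e (G : GalileanFrame t c e f) (x : Spc d) (i j : Fin q) (m : Fin d) :
    (f x i ⬝ᵥ fun a => pd (fun y => e y j a) m x)
      + (f x j ⬝ᵥ fun a => pd (fun y => e y i a) m x)
      + ∑ b, e x i b * ∑ a, e x j a * pd (fun y => hhatOf d q f y a b) m x = 0 := by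
  have h1 : ∀ b, ∑ a, (pd (fun y => e y j a) m x * hhatOf d q f x a b
      + e x j a * pd (fun y => hhatOf d q f y a b) m x) = pd (fun y => f y j b) m x :=
    fun b => by
      rw [← pd_sum_mul (fun a => G.esm j a) (fun a => sm_hhatOf G.fsm a b)]
      simp only [(G.dual _).sum_mul_hhatOf_e]
  have h2 : ∑ b, (pd (fun y => e y i b) m x * f x j b
      + e x i b * pd (fun y => f y j b) m x) = 0 := by
    rw [← pd_sum_mul (fun a => G.esm i a) (fun a => G.fsm j a)]
    have : ∀ y, ∑ a, e y i a * f y j a = if j = i then (1 : ℝ) else 0 := fun y => by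
      rw [← (G.dual y).fe j i, dotProduct_comm]; rfl
    simp only [this, pd_const]
  have h3 : ∑ b, e x i b * ∑ a, pd (fun y => e y j a) m x * hhatOf d q f x a b
      = ∑ a, f x i a * pd (fun y => e y j a) m x := by
    simp only [← (G.dual x).sum_mul_hhatOf_e i, Finset.mul_sum, Finset.sum_mul]
    rw [Finset.sum_comm]
    refine Finset.sum_congr rfl fun a _ => Finset.sum_congr rfl fun b _ => ?_
    rw [hhatOf_symm f x a b]; ring
  simp only [← h1, Finset.sum_add_distrib, mul_add, h3] at h2
  simp only [dotProduct, mul_comm (f x j _)]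
  linarith

theorem sum_e_e_chris (x : Spc d) (i j : Fin q) (m : Fin d) :
    ∑ k, e x i k * (e x j ⬝ᵥ fun l => chris (hhatOf d q f) x l k m)
      + ∑ k, e x j k * (e x i ⬝ᵥ fun l => chris (hhatOf d q f) x l k m)
      = ∑ b, e x i b * ∑ a, e x j a * pd (fun y => hhatOf d q f y a b) m x := by
  simp only [dotProduct, Finset.mul_sum]
  rw [Finset.sum_comm (f := fun k l => e x j k * (e x i l * _)), ← Finset.sum_add_distrib]
  refine Finset.sum_congr rfl fun b _ => ?_
  rw [← Finset.sum_add_distrib]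
  refine Finset.sum_congr rfl fun a _ => ?_
  rw [← chris_add_chris (hhatOf_symm f) x a b m]
  ring

theorem covd_e_skew (G : GalileanFrame t c e f) (x : Spc d) (i j : Fin q) (m : Fin d) :
    (f x j ⬝ᵥ fun a => covd d (SpecialConn d p q t c e f) (fun y => e y i) m a x)
      + (f x i ⬝ᵥ fun a => covd d (SpecialConn d p q t c e f) (fun y => e y j) m a x) = 0 := by
  have expand : ∀ i j,
      (f x j ⬝ᵥ fun a => covd d (SpecialConn d p q t c e f) (fun y => e y i) m a x)
      = (f x j ⬝ᵥ fun a => pd (fun y => e y i a) m x)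
        + ∑ k, e x i k * (e x j ⬝ᵥ fun l => chris (hhatOf d q f) x l k m) := fun i j => by
    simp only [← G.f_dotProduct_specialConn]
    simp only [covd, dotProduct, mul_add, Finset.sum_add_distrib, Finset.mul_sum]
    congr 1
    rw [Finset.sum_comm]
    exact Finset.sum_congr rfl fun _ _ => Finset.sum_congr rfl fun _ _ => by ring
  rw [expand, expand]
  have h1 := G.sum_f_mul_pd_e x i j m
  have h2 := sum_e_e_chris (e := e) (f := f) x i j m
  linarith

theorem sum_covd_e (G : GalileanFrame t c e f) (Γ : Spc d → Fin d → Fin d → Fin d → ℝ)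
    (x : Spc d) (a b m : Fin d) :
    pd (fun y => hOf d q e y a b) m x + (∑ k, Γ x a k m * hOf d q e x k b)
        + (∑ k, Γ x b k m * hOf d q e x a k)
      = ∑ i, (covd d Γ (fun y => e y i) m a x * e x i b
          + e x i a * covd d Γ (fun y => e y i) m b x) := by
  unfold hOf covd
  rw [pd_sum_mul (fun i => G.esm i a) (fun i => G.esm i b)]
  simp only [add_mul, mul_add, Finset.sum_add_distrib, Finset.mul_sum, Finset.sum_mul]
  rw [Finset.sum_comm (f := fun k i => Γ x a k m * _),
    Finset.sum_comm (f := fun k i => Γ x b k m * _)]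
  have h1 : ∑ i, ∑ k, Γ x a k m * (e x i k * e x i b) = ∑ i, ∑ k, Γ x a k m * e x i k * e x i b :=
    Finset.sum_congr rfl fun _ _ => Finset.sum_congr rfl fun _ _ => by ring
  have h2 : ∑ i, ∑ k, Γ x b k m * (e x i a * e x i k)
      = ∑ i, ∑ k, e x i a * (Γ x b k m * e x i k) :=
    Finset.sum_congr rfl fun _ _ => Finset.sum_congr rfl fun _ _ => by ring
  rw [h1, h2]
  ring

theorem compatUpper_specialConn (G : GalileanFrame t c e f)
    (hlow : CompatLower d (SpecialConn d p q t c e f) (tauOf d p c)) :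
    CompatUpper d (SpecialConn d p q t c e f) (hOf d q e) := by
  intro x a b m
  rw [G.sum_covd_e]
  set N : Fin q → Fin d → ℝ :=
    fun i a => covd d (SpecialConn d p q t c e f) (fun y => e y i) m a x with hN
  have hexp : ∀ i a, N i a = ∑ j, e x j a * (f x j ⬝ᵥ N i) := fun i a => by
    rw [(G.dual x).vector_expand (N i) a]
    simp [hN, G.c_dotProduct_covd_e hlow]
  have hskew : ∀ i j, (f x j ⬝ᵥ N i) + (f x i ⬝ᵥ N j) = 0 := fun i j => G.covd_e_skew x i j m
  change ∑ i, (N i a * e x i b + e x i a * N i b) = 0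
  calc ∑ i, (N i a * e x i b + e x i a * N i b)
      = (∑ i, ∑ j, e x j a * (f x j ⬝ᵥ N i) * e x i b)
        + ∑ i, ∑ j, e x i a * (e x j b * (f x j ⬝ᵥ N i)) := by
        simp only [hexp _ a, hexp _ b, Finset.sum_add_distrib, Finset.sum_mul, Finset.mul_sum]
    _ = ∑ j, ∑ i, e x j a * e x i b * ((f x j ⬝ᵥ N i) + (f x i ⬝ᵥ N j)) := by
        rw [Finset.sum_comm]
        simp only [← Finset.sum_add_distrib]
        exact Finset.sum_congr rfl fun _ _ => Finset.sum_congr rfl fun _ _ => by ring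
    _ = 0 := by simp [hskew]

end GalileanFrame

theorem contract_alternating {d : ℕ} {ι : Type*} [Fintype ι] (α X : ι → Fin d → ℝ)
    (u v : Fin d → ℝ) :
    ∑ μ, ∑ ν, u μ * (∑ i, α i μ * X i ν - ∑ i, α i ν * X i μ) * v ν
      = ∑ i, ((α i ⬝ᵥ u) * (X i ⬝ᵥ v) - (α i ⬝ᵥ v) * (X i ⬝ᵥ u)) := by
  simp only [dotProduct, Finset.sum_mul_sum, ← Finset.sum_sub_distrib]
  rw [Finset.sum_comm]
  simp only [Finset.mul_sum, Finset.sum_mul]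
  rw [Finset.sum_comm]
  have h : ∀ i, ∑ a, ∑ b, (α i a * u a * (X i b * v b) - α i a * v a * (X i b * u b))
      = ∑ a, ∑ b, u a * (α i a * X i b - α i b * X i a) * v b := fun i => by
    have h1 : ∑ a, ∑ b, α i a * v a * (X i b * u b) = ∑ a, ∑ b, α i b * v b * (X i a * u a) :=
      Finset.sum_comm
    simp only [Finset.sum_sub_distrib, h1]
    simp only [← Finset.sum_sub_distrib]
    exact Finset.sum_congr rfl fun _ _ => Finset.sum_congr rfl fun _ _ => by ring
  simp only [h]
  rw [Finset.sum_comm]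
  conv_rhs => rw [Finset.sum_comm]; enter [2, a]; rw [Finset.sum_comm]
  rw [Finset.sum_comm]

namespace GalileanFrame

variable {d p q : ℕ} {t c : Spc d → Fin (p + 1) → Fin d → ℝ} {e f : Spc d → Fin q → Fin d → ℝ}

theorem c_dotProduct_eq_zero (G : GalileanFrame t c e f) {x : Spc d} {v : Fin d → ℝ}
    (hv : ∀ a, ∑ b, tauOf d p c x a b * v b = 0) (A : Fin (p + 1)) : c x A ⬝ᵥ v = 0 := by
  refine (G.dual x).dotProduct_eq_zero (fun b => ?_) A
  simpa only [tauOf_symm c x b, mul_comm _ (v _)] using hv b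

theorem sum_pd_t_mul_hhatOf (G : GalileanFrame t c e f) (x : Spc d) (A : Fin (p + 1))
    (b m : Fin d) :
    ∑ a, pd (fun y => t y A a) m x * hhatOf d q f x a b
      = -∑ a, t x A a * pd (fun y => hhatOf d q f y a b) m x := by
  have h := pd_sum_mul (fun a => G.tsm A a) (fun a => sm_hhatOf G.fsm a b) m x
  simp only [(G.dual _).sum_mul_hhatOf_t, pd_const, Finset.sum_add_distrib] at h
  linarith

/-- `t_A^k t_B^l Γ̂_{l k a}`, with `Γ̂` the first-kind Christoffel symbols of `ĥ`. -/
def ttChris (t : Spc d → Fin (p + 1) → Fin d → ℝ) (f : Spc d → Fin q → Fin d → ℝ) (x : Spc d)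
    (A B : Fin (p + 1)) (a : Fin d) : ℝ :=
  ∑ k, t x A k * (t x B ⬝ᵥ fun l => chris (hhatOf d q f) x l k a)

theorem ttChris_skew (G : GalileanFrame t c e f) (x : Spc d) (A B : Fin (p + 1)) (a : Fin d) :
    ttChris t f x A B a = -ttChris t f x B A a := by
  have h1 : ttChris t f x A B a + ttChris t f x B A a
      = ∑ k, t x A k * ∑ l, t x B l * pd (fun y => hhatOf d q f y l k) a x := by
    simp only [ttChris, dotProduct, Finset.mul_sum]
    rw [Finset.sum_comm (f := fun k l => t x B k * (t x A l * _)), ← Finset.sum_add_distrib]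
    refine Finset.sum_congr rfl fun k _ => ?_
    rw [← Finset.sum_add_distrib]
    refine Finset.sum_congr rfl fun l _ => ?_
    rw [← chris_add_chris (hhatOf_symm f) x l k a]
    ring
  have h2 : ∑ k, t x A k * ∑ l, pd (fun y => t y B l) a x * hhatOf d q f x l k
      = ∑ l, pd (fun y => t y B l) a x * ∑ k, t x A k * hhatOf d q f x k l := by
    simp only [Finset.mul_sum]
    rw [Finset.sum_comm]
    refine Finset.sum_congr rfl fun l _ => Finset.sum_congr rfl fun k _ => ?_
    rw [hhatOf_symm f x l k]; ring
  simp only [(G.dual x).sum_mul_hhatOf_t, sum_pd_t_mul_hhatOf G, mul_zero,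
    Finset.sum_const_zero, mul_neg, Finset.sum_neg_distrib] at h2
  linarith

theorem sum_hhatOf_mul_covd_t (G : GalileanFrame t c e f) (x : Spc d) (A : Fin (p + 1))
    (a b : Fin d) :
    ∑ k, hhatOf d q f x k b * covd d (SpecialConn d p q t c e f) (fun y => t y A) a k x
      = ∑ k, t x A k * (chris (hhatOf d q f) x b k a - pd (fun y => hhatOf d q f y k b) a x)
        - ∑ B, c x B b * ttChris t f x A B a := by
  have h1 : ∀ k, ∑ l, hhatOf d q f x l b * SpecialConn d p q t c e f x l k a
      = chris (hhatOf d q f) x b k a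
        - ∑ B, c x B b * (t x B ⬝ᵥ fun l => chris (hhatOf d q f) x l k a) := fun k => by
    have h := (G.dual x).covector_expand (fun l => chris (hhatOf d q f) x l k a) b
    simp only [mul_comm (hhatOf d q f x _ b)]
    rw [sum_mul_hhatOf]
    simp only [G.f_dotProduct_specialConn]
    linarith
  have h2 : ∑ k, hhatOf d q f x k b * ∑ l, SpecialConn d p q t c e f x k l a * t x A l
      = ∑ l, t x A l * ∑ k, hhatOf d q f x k b * SpecialConn d p q t c e f x k l a := by
    simp only [Finset.mul_sum]
    rw [Finset.sum_comm]
    exact Finset.sum_congr rfl fun _ _ => Finset.sum_congr rfl fun _ _ => by ring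
  have h3 : ∑ k, t x A k * ∑ B, c x B b * (t x B ⬝ᵥ fun l => chris (hhatOf d q f) x l k a)
      = ∑ B, c x B b * ttChris t f x A B a := by
    simp only [ttChris, Finset.mul_sum]
    rw [Finset.sum_comm]
    exact Finset.sum_congr rfl fun _ _ => Finset.sum_congr rfl fun _ _ => by ring
  have h4 := G.sum_pd_t_mul_hhatOf x A b a
  simp only [covd, mul_add, Finset.sum_add_distrib, h2, h1, mul_sub, Finset.sum_sub_distrib, h3]
  simp only [mul_comm (hhatOf d q f x _ b), h4]
  ring

theorem fstr_specialConn (G : GalileanFrame t c e f) (x : Spc d) (A : Fin (p + 1))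
    (a b : Fin d) :
    Fstr d p (SpecialConn d p q t c e f) t (hhatOf d q f) A a b x
      = ∑ B, c x B a * ttChris t f x A B b - ∑ B, c x B b * ttChris t f x A B a := by
  have h : ∑ k, t x A k * (chris (hhatOf d q f) x b k a - pd (fun y => hhatOf d q f y k b) a x)
      = ∑ k, t x A k *
        (chris (hhatOf d q f) x a k b - pd (fun y => hhatOf d q f y k a) b x) := by
    refine Finset.sum_congr rfl fun k _ => ?_
    unfold chris
    rw [pd_swap (hhatOf_symm f) a b, pd_swap (hhatOf_symm f) k b, pd_swap (hhatOf_symm f) k a]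
    ring
  rw [Fstr, Finset.sum_sub_distrib, G.sum_hhatOf_mul_covd_t, G.sum_hhatOf_mul_covd_t, h]
  ring

theorem fInKer_specialConn (G : GalileanFrame t c e f) :
    FInKer d p (tauOf d p c) t
      (fun A a b x => Fstr d p (SpecialConn d p q t c e f) t (hhatOf d q f) A a b x) := by
  refine ⟨fun x A B v hv => ?_, fun x A v w hv hw => ?_⟩
  · simp only [G.fstr_specialConn, contract_alternating, (G.dual x).ct,
      G.c_dotProduct_eq_zero hv]
    simp only [ite_mul, one_mul, zero_mul, sub_zero, Finset.sum_ite_eq', Finset.mem_univ, if_true]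
    simp [dotProduct, G.ttChris_skew x A B]
  · simp only [G.fstr_specialConn, contract_alternating, G.c_dotProduct_eq_zero hv,
      G.c_dotProduct_eq_zero hw]
    simp

end GalileanFrame

theorem eq_zero_of_symm_of_skew {ι : Type*} {L : ι → ι → ι → ℝ}
    (hsymm : ∀ a b m, L a b m = L a m b) (hskew : ∀ a b m, L a b m + L b a m = 0)
    (a b m : ι) : L a b m = 0 := by
  linarith [hskew a b m, hskew b m a, hskew m a b, hsymm a b m, hsymm b m a, hsymm m a b]

/-- The difference of two torsion-free compatible connections vanishes once its contribution to
the gravitational field strength lies in the kernel of `φ`. -/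
theorem DualFrames.connection_difference_eq_zero {d p q : ℕ}
    {t c : Spc d → Fin (p + 1) → Fin d → ℝ} {e f : Spc d → Fin q → Fin d → ℝ} {x : Spc d}
    (F : DualFrames (t x) (c x) (e x) (f x)) {S : Fin d → Fin d → Fin d → ℝ}
    (hS : ∀ l μ ν, S l μ ν = S l ν μ)
    (hlow : ∀ a b m, (∑ l, S l a m * tauOf d p c x l b)
      + ∑ l, S l b m * tauOf d p c x a l = 0)
    (hup : ∀ a b m, (∑ k, S a k m * hOf d q e x k b) + ∑ k, S b k m * hOf d q e x a k = 0)
    (htv : ∀ A B i, (∑ μ, ∑ ν, t x B μ *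
        (∑ l, (hhatOf d q f x l ν * ∑ k, S l k μ * t x A k
          - hhatOf d q f x l μ * ∑ k, S l k ν * t x A k)) * e x i ν)
      = -∑ μ, ∑ ν, t x A μ *
        (∑ l, (hhatOf d q f x l ν * ∑ k, S l k μ * t x B k
          - hhatOf d q f x l μ * ∑ k, S l k ν * t x B k)) * e x i ν)
    (hvw : ∀ A i j, (∑ μ, ∑ ν, e x j μ *
        (∑ l, (hhatOf d q f x l ν * ∑ k, S l k μ * t x A k
          - hhatOf d q f x l μ * ∑ k, S l k ν * t x A k)) * e x i ν) = 0)
    (l μ ν : Fin d) : S l μ ν = 0 := by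
  have hc : ∀ A a m, c x A ⬝ᵥ (fun l => S l a m) = 0 := fun A a m => by
    refine F.dotProduct_eq_zero (fun b => ?_) A
    refine eq_zero_of_symm_of_skew (L := fun b a m => ∑ l, S l a m * tauOf d p c x l b)
      (fun b a m => by simp only [hS _ a m]) (fun b a m => ?_) b a m
    rw [← hlow a b m]
    simp only [tauOf_symm c x a]
  set s : Fin q → Fin d → Fin d → ℝ := fun i k m => f x i ⬝ᵥ fun l => S l k m with hs
  have s_symm : ∀ i k m, s i k m = s i m k := fun i k m => by simp only [hs, hS _ k m]
  set r : Fin q → Fin q → Fin d → ℝ := fun i j m => ∑ k, s i k m * e x j k with hr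
  set X : Fin (p + 1) → Fin q → Fin d → ℝ := fun A i m => ∑ k, s i k m * t x A k with hX
  have hf : ∀ a j, ∑ b, f x j b * hOf d q e x a b = e x j a := fun a j => by
    have h : ∀ i, ∑ b, f x j b * (e x i a * e x i b)
        = e x i a * if j = i then (1 : ℝ) else 0 := fun i => by
      rw [← F.fe j i, show f x j ⬝ᵥ e x i = ∑ b, f x j b * e x i b from rfl, Finset.mul_sum]
      exact Finset.sum_congr rfl fun _ _ => by ring
    simp only [hOf, Finset.mul_sum]
    rw [Finset.sum_comm]
    simp [h]
  have h_symm : ∀ a b, hOf d q e x a b = hOf d q e x b a := hhatOf_symm e x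
  have r_skew : ∀ i j m, r i j m + r j i m = 0 := fun i j m => by
    have h0 : ∑ a, ∑ b, f x i a * f x j b * ((∑ k, S a k m * hOf d q e x k b)
        + ∑ k, S b k m * hOf d q e x a k) = 0 := by simp [hup]
    have h1 : ∀ i j, ∑ a, ∑ b, f x i a * f x j b * (∑ k, S a k m * hOf d q e x k b)
        = r i j m := fun i j => by
      simp only [hr, hs, dotProduct, ← hf _ j, Finset.mul_sum, Finset.sum_mul]
      rw [Finset.sum_congr rfl fun a _ => Finset.sum_comm, Finset.sum_comm]
      refine Finset.sum_congr rfl fun k _ => ?_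
      exact Finset.sum_congr rfl fun _ _ => Finset.sum_congr rfl fun _ _ => by ring
    have h2 : ∑ a, ∑ b, f x i a * f x j b * (∑ k, S b k m * hOf d q e x a k) = r j i m := by
      rw [← h1 j i, Finset.sum_comm]
      refine Finset.sum_congr rfl fun b _ => Finset.sum_congr rfl fun a _ => ?_
      simp only [h_symm a, mul_comm (f x i a)]
    simp only [mul_add, Finset.sum_add_distrib, h1, h2] at h0
    exact h0
  have hG : ∀ A μ ν, ∑ l, (hhatOf d q f x l ν * ∑ k, S l k μ * t x A k
      - hhatOf d q f x l μ * ∑ k, S l k ν * t x A k)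
      = ∑ i, X A i μ * f x i ν - ∑ i, X A i ν * f x i μ := fun A μ ν => by
    have h : ∀ μ ν, ∑ l, hhatOf d q f x l ν * ∑ k, S l k μ * t x A k
        = ∑ i, X A i μ * f x i ν := fun μ ν => by
      have h' := sum_mul_hhatOf f x (fun l => ∑ k, S l k μ * t x A k) ν
      simp only [mul_comm (hhatOf d q f x _ ν)]
      rw [h']
      refine Finset.sum_congr rfl fun i _ => ?_
      rw [mul_comm]
      congr 1
      simp only [hX, hs, dotProduct, Finset.mul_sum, Finset.sum_mul]
      rw [Finset.sum_comm]
      exact Finset.sum_congr rfl fun _ _ => Finset.sum_congr rfl fun _ _ => by ring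
    rw [Finset.sum_sub_distrib, h, h]
  simp only [hG, contract_alternating, F.ft, F.fe] at htv hvw
  simp only [mul_ite, mul_one, mul_zero, sub_zero, Finset.sum_sub_distrib, Finset.sum_ite_eq',
    Finset.mem_univ, if_true] at htv hvw
  have cross : ∀ (i : Fin q) (u v : Fin d → ℝ), (fun m => ∑ k, s i k m * u k) ⬝ᵥ v
      = (fun m => ∑ k, s i k m * v k) ⬝ᵥ u := fun i u v => by
    simp only [dotProduct, Finset.sum_mul]
    rw [Finset.sum_comm]
    refine Finset.sum_congr rfl fun _ _ => Finset.sum_congr rfl fun _ _ => ?_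
    rw [s_symm]; ring
  have X_t : ∀ A B i, t x B ⬝ᵥ X A i = 0 := fun A B i => by
    have h1 := htv A B i
    have h2 := cross i (t x A) (t x B)
    rw [dotProduct_comm]
    change X A i ⬝ᵥ t x B = X B i ⬝ᵥ t x A at h2
    linarith
  have X_r : ∀ A i j, X A i ⬝ᵥ e x j = t x A ⬝ᵥ r i j := fun A i j => by
    rw [dotProduct_comm (t x A)]; exact cross i _ _
  have r_eq : ∀ i j, r i j = -r j i := fun i j => by
    funext m; simp only [Pi.neg_apply]; linarith [r_skew i j m]
  have r_t : ∀ A i j, t x A ⬝ᵥ r i j = 0 := fun A i j => by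
    have h1 := hvw A i j
    rw [X_r, X_r, r_eq j i, dotProduct_neg] at h1
    linarith
  have r_e : ∀ i j k, e x k ⬝ᵥ r i j = 0 := fun i j k => by
    refine eq_zero_of_symm_of_skew (L := fun i j k => e x k ⬝ᵥ r i j) (fun i j k => ?_)
      (fun i j k => ?_) i j k
    · have h := cross i (e x j) (e x k)
      rw [dotProduct_comm _ (e x k), dotProduct_comm _ (e x j)] at h
      exact h
    · rw [r_eq j i, dotProduct_neg, add_neg_cancel]
  have r_zero : ∀ i j m, r i j m = 0 := fun i j =>
    F.covector_eq_zero (fun A => r_t A i j) (r_e i j)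
  have X_zero : ∀ A i m, X A i m = 0 := fun A i =>
    F.covector_eq_zero (fun B => X_t A B i)
      (fun j => by rw [dotProduct_comm, X_r, r_t])
  have s_zero : ∀ i k m, s i k m = 0 := fun i k m =>
    F.covector_eq_zero (u := fun k => s i k m)
      (fun A => by rw [dotProduct_comm]; exact X_zero A i m)
      (fun j => by rw [dotProduct_comm]; exact r_zero i j m) k
  exact F.vector_eq_zero (v := fun l => S l μ ν) (fun A => hc A μ ν) (fun i => s_zero i μ ν) l

theorem GalileanFrame.goodConn_unique {d p q : ℕ} {t c : Spc d → Fin (p + 1) → Fin d → ℝ}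
    {e f : Spc d → Fin q → Fin d → ℝ} (G : GalileanFrame t c e f)
    {Γ Γ' : Spc d → Fin d → Fin d → Fin d → ℝ} (hΓ : GoodConn d p q t c e f Γ)
    (hΓ' : GoodConn d p q t c e f Γ') : Γ = Γ' := by
  obtain ⟨-, sym, low, up, ker⟩ := hΓ
  obtain ⟨-, sym', low', up', ker'⟩ := hΓ'
  funext x l μ ν
  have hF : ∀ A a b, (∑ l, (hhatOf d q f x l b * ∑ k, (Γ x l k a - Γ' x l k a) * t x A k
      - hhatOf d q f x l a * ∑ k, (Γ x l k b - Γ' x l k b) * t x A k))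
      = Fstr d p Γ t (hhatOf d q f) A a b x - Fstr d p Γ' t (hhatOf d q f) A a b x :=
    fun A a b => by
      simp only [Fstr, covd, sub_mul, ← Finset.sum_sub_distrib]
      refine Finset.sum_congr rfl fun l _ => ?_
      simp only [Finset.sum_sub_distrib]
      ring
  refine sub_eq_zero.1 ((G.dual x).connection_difference_eq_zero
    (S := fun l μ ν => Γ x l μ ν - Γ' x l μ ν) (fun l μ ν => ?_) (fun a b m => ?_)
    (fun a b m => ?_) (fun A B i => ?_) (fun A i j => ?_) l μ ν)
  · simp only [sym x l μ ν, sym' x l μ ν]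
  · simp only [sub_mul, Finset.sum_sub_distrib]
    linarith [low x a b m, low' x a b m]
  · simp only [sub_mul, Finset.sum_sub_distrib]
    linarith [up x a b m, up' x a b m]
  · simp only [hF]
    simp only [mul_sub, sub_mul, Finset.sum_sub_distrib]
    linarith [ker.1 x A B _ (G.e_transverse x i), ker'.1 x A B _ (G.e_transverse x i)]
  · simp only [hF]
    simp only [mul_sub, sub_mul, Finset.sum_sub_distrib]
    linarith [ker.2 x A _ _ (G.e_transverse x j) (G.e_transverse x i),
      ker'.2 x A _ _ (G.e_transverse x j) (G.e_transverse x i)]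

/-- Proposition 9: for an Augustinian pNC structure and a longitudinal frame `τ_A`
(completed to a Galilean `p`-frame), there is a unique torsion-free compatible
connection whose induced gravitational field strength class vanishes, and its
coefficients are given by the explicit formula `SpecialConn`. -/
theorem special_connection_exists_unique (d p q : ℕ)
    (t c : Spc d → Fin (p+1) → Fin d → ℝ) (e f : Spc d → Fin q → Fin d → ℝ)
    (htsm : ∀ A a, Sm (fun x => t x A a)) (hcsm : ∀ A a, Sm (fun x => c x A a))
    (hesm : ∀ i a, Sm (fun x => e x i a)) (hfsm : ∀ i a, Sm (fun x => f x i a))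
    (hct : ∀ x A B, ∑ a, c x A a * t x B a = if A = B then (1:ℝ) else 0)
    (hce : ∀ x A i, ∑ a, c x A a * e x i a = 0)
    (hft : ∀ x i A, ∑ a, f x i a * t x A a = 0)
    (hfe : ∀ x i j, ∑ a, f x i a * e x j a = if i = j then (1:ℝ) else 0)
    (hcomp : ∀ x a b, ((∑ A, t x A a * c x A b) + ∑ i, e x i a * f x i b)
      = if a = b then (1:ℝ) else 0)
    (haug1 : ∀ x A (v w : Fin d → ℝ),
      (∀ a, ∑ b, tauOf d p c x a b * v b = 0) →
      (∀ a, ∑ b, tauOf d p c x a b * w b = 0) →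
      ∑ μ, ∑ ν, v μ * w ν *
        (pd (fun y => c y A ν) μ x - pd (fun y => c y A μ) ν x) = 0)
    (haug2 : ∀ x B C (v : Fin d → ℝ),
      (∀ a, ∑ b, tauOf d p c x a b * v b = 0) →
      ∑ A, (eta' p A B * (∑ μ, ∑ ν, t x C μ * v ν *
              (pd (fun y => c y A ν) μ x - pd (fun y => c y A μ) ν x))
          + eta' p A C * (∑ μ, ∑ ν, t x B μ * v ν *
              (pd (fun y => c y A ν) μ x - pd (fun y => c y A μ) ν x))) = 0) :
    GoodConn d p q t c e f (SpecialConn d p q t c e f) ∧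
    ∀ Γ, GoodConn d p q t c e f Γ → Γ = SpecialConn d p q t c e f := by
  have G : GalileanFrame t c e f :=
    ⟨htsm, hcsm, hesm, hfsm, fun x => ⟨hct x, hce x, hft x, hfe x, hcomp x⟩⟩
  have low := G.compatLower_specialConn (G.dotProduct_chris_tauOf_eq_zero haug1 haug2)
  have good : GoodConn d p q t c e f (SpecialConn d p q t c e f) :=
    ⟨G.sm_specialConn, GalileanFrame.specialConn_symm, low, G.compatUpper_specialConn low,
      G.fInKer_specialConn⟩
  exact ⟨good, fun Γ hΓ => G.goodConn_unique hΓ good⟩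
end
end
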